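/- Let K : M → ℝ³ be the Klein-model projection K(x,y,z,w) = (x/w, y/w, z), and fix ρ₀ > 0, θ₀ ∈ ℝ and z₀ ≠ 0. For the geodesic γ(t) = (sinh(ρ₀ t) cos θ₀, sinh(ρ₀ t) sin θ₀, z₀ t, cosh(ρ₀ t)) one has K(γ(t)) = (tanh(ρ₀ t) cos θ₀, tanh(ρ₀ t) sin θ₀, z₀ t), and the three points K(γ(0)), K(γ(1)), K(γ(2)) are not collinear in ℝ³. Hence the image in (Klein model)×E of a geodesic of H²×E that is neither horizontal nor vertical is not a straight line. -/

import Mathlib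

open Real

/-- The Klein-model projection K(x,y,z,w) = (x/w, y/w, z). -/
noncomputable def kleinProj (p : ℝ × ℝ × ℝ × ℝ) : ℝ × ℝ × ℝ :=
  (p.1 / p.2.2.2, p.2.1 / p.2.2.2, p.2.2.1)

theorem tanh_two_mul_ne {x : ℝ} (hx : 0 < x) : Real.tanh (2 * x) ≠ 2 * Real.tanh x := by
  have hs : 0 < Real.sinh x := Real.sinh_pos_iff.2 hx
  have hc : 0 < Real.cosh x := Real.cosh_pos x
  have hd : 0 < Real.cosh x ^ 2 + Real.sinh x ^ 2 := by positivity
  rw [Real.tanh_eq_sinh_div_cosh, Real.tanh_eq_sinh_div_cosh, Real.sinh_two_mul,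
    Real.cosh_two_mul, ← mul_div_assoc, Ne, div_eq_div_iff hd.ne' hc.ne']
  intro h
  have : 2 * Real.sinh x ^ 3 = 0 := by linear_combination -h
  exact (by positivity : 2 * Real.sinh x ^ 3 ≠ 0) this

theorem klein_image_of_diagonal_geodesic_not_straight
    (ρ₀ θ₀ z₀ : ℝ) (hρ₀ : 0 < ρ₀) (hz₀ : z₀ ≠ 0)
    (γ : ℝ → ℝ × ℝ × ℝ × ℝ)
    (hγ : γ = fun t => (Real.sinh (ρ₀ * t) * Real.cos θ₀,
      Real.sinh (ρ₀ * t) * Real.sin θ₀, z₀ * t, Real.cosh (ρ₀ * t))) :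
    (∀ t : ℝ, kleinProj (γ t) =
      (Real.tanh (ρ₀ * t) * Real.cos θ₀, Real.tanh (ρ₀ * t) * Real.sin θ₀, z₀ * t)) ∧
    ¬ Collinear ℝ ({kleinProj (γ 0), kleinProj (γ 1), kleinProj (γ 2)} :
      Set (ℝ × ℝ × ℝ)) := by
  have hK : ∀ t : ℝ, kleinProj (γ t) =
      (Real.tanh (ρ₀ * t) * Real.cos θ₀, Real.tanh (ρ₀ * t) * Real.sin θ₀, z₀ * t) := by
    intro t
    simp only [hγ, kleinProj, Real.tanh_eq_sinh_div_cosh, div_mul_eq_mul_div]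
  refine ⟨hK, fun hcol => ?_⟩
  obtain ⟨v, hv⟩ := (collinear_iff_of_mem (p₀ := kleinProj (γ 0)) (by simp)).1 hcol
  obtain ⟨r, hr⟩ := hv (kleinProj (γ 1)) (by simp)
  obtain ⟨s, hs⟩ := hv (kleinProj (γ 2)) (by simp)
  simp only [hK, Prod.ext_iff, vadd_eq_add, Prod.fst_add, Prod.snd_add, Prod.smul_fst,
    Prod.smul_snd, smul_eq_mul, mul_zero, Real.tanh_zero, zero_mul, add_zero, mul_one] at hr hs
  obtain ⟨hrx, hry, hrz⟩ := hr
  obtain ⟨hsx, hsy, hsz⟩ := hs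
  have hv₀ : v.2.2 ≠ 0 := fun h => hz₀ (by rw [hrz, h, mul_zero])
  have hsr : s = 2 * r := mul_right_cancel₀ hv₀ (by linear_combination 2 * hrz - hsz)
  subst hsr
  apply tanh_two_mul_ne hρ₀
  rw [mul_comm 2 ρ₀]
  linear_combination Real.cos θ₀ * (hsx - 2 * hrx) + Real.sin θ₀ * (hsy - 2 * hry)
    - (Real.tanh (ρ₀ * 2) - 2 * Real.tanh ρ₀) * Real.sin_sq_add_cos_sq θ₀
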